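/- Fix q ∈ ℝ with 0 < q < 1/2 and let W(H) be the Whittle index sequence W(H) := (H(a(H−1)−a(H)) + a(H)) / ((H−1)(a(H−1)−a(H)) + a(H) + q), where a(Δ) := (Q(q)^Δ)_{1,0}. Then for every real D with 0 ≤ D < 1/(1+2q) there exists an integer H ≥ 1 such that W(H) ≤ D < W(H+1), and this H is unique. (The threshold policy with this H is then optimal for the decoupled problem with effective transmission cost D.) -/

import Mathlib

open Matrix

/-- The one-step transition matrix of a symmetric two-state Markov chain
with switching probability `q`. -/
def Qmat (q : ℝ) : Matrix (Fin 2) (Fin 2) ℝ := !![1 - q, q; q, 1 - q]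

/-- `a q Δ` is the `(1,0)` entry of the `Δ`-th power of `Qmat q`. -/
def a (q : ℝ) (Δ : ℕ) : ℝ := (Qmat q ^ Δ) 1 0

/-- The Whittle index in state `(X̂ = 1, AoI = H)`. -/
noncomputable def W (q : ℝ) (H : ℕ) : ℝ :=
  ((H : ℝ) * (a q (H - 1) - a q H) + a q H) /
    (((H : ℝ) - 1) * (a q (H - 1) - a q H) + a q H + q)

theorem Qmat_pow (q : ℝ) (n : ℕ) :
    Qmat q ^ n = !![(1 + (1 - 2 * q) ^ n) / 2, (1 - (1 - 2 * q) ^ n) / 2;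
      (1 - (1 - 2 * q) ^ n) / 2, (1 + (1 - 2 * q) ^ n) / 2] := by
  induction n with
  | zero => ext i j; fin_cases i <;> fin_cases j <;> simp
  | succ n ih =>
    rw [pow_succ, ih, Qmat]
    ext i j
    fin_cases i <;> fin_cases j <;> simp [Matrix.mul_apply, Fin.sum_univ_two] <;> ring

theorem a_eq (q : ℝ) (n : ℕ) : a q n = (1 - (1 - 2 * q) ^ n) / 2 := by
  simp [a, Qmat_pow]

/-- Twice the numerator of `W q (n + 1)`. -/
def whittleNum (q : ℝ) (n : ℕ) : ℝ := 1 - (1 - 2 * q) ^ n * (1 + 2 * q * n)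

theorem W_succ (q : ℝ) (n : ℕ) :
    W q (n + 1) =
      whittleNum q n / (whittleNum q n + 2 * q * (1 + (1 - 2 * q) ^ n)) := by
  rw [W, a_eq, a_eq, whittleNum, ← mul_div_mul_left _ _ (two_ne_zero (α := ℝ))]
  simp only [Nat.add_sub_cancel, pow_succ]
  push_cast
  congr 1 <;> ring

theorem whittleNum_strictMono {q : ℝ} (hq0 : 0 < q) (hq1 : q < 1 / 2) :
    StrictMono (whittleNum q) := by
  refine strictMono_nat_of_lt_succ fun n => ?_
  have hp : 0 < (1 - 2 * q) ^ n := pow_pos (by linarith) n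
  have h : whittleNum q (n + 1) - whittleNum q n =
      (1 - 2 * q) ^ n * ((2 * q) ^ 2 * (n + 1)) := by
    simp only [whittleNum, pow_succ]
    push_cast
    ring
  have : 0 < (1 - 2 * q) ^ n * ((2 * q) ^ 2 * (n + 1)) := by positivity
  linarith

theorem whittleNum_nonneg {q : ℝ} (hq0 : 0 < q) (hq1 : q < 1 / 2) (n : ℕ) :
    0 ≤ whittleNum q n := by
  simpa [whittleNum] using (whittleNum_strictMono hq0 hq1).monotone (Nat.zero_le n)

theorem W_succ_strictMono {q : ℝ} (hq0 : 0 < q) (hq1 : q < 1 / 2) :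
    StrictMono fun n => W q (n + 1) := by
  intro m n hmn
  have hr : 0 < 1 - 2 * q := by linarith
  have hpm : 0 < (1 - 2 * q) ^ m := pow_pos hr m
  have hpn : 0 < (1 - 2 * q) ^ n := pow_pos hr n
  have hp : (1 - 2 * q) ^ n ≤ (1 - 2 * q) ^ m :=
    pow_le_pow_of_le_one hr.le (by linarith) hmn.le
  have hN := whittleNum_strictMono hq0 hq1 hmn
  have hm := whittleNum_nonneg hq0 hq1 m
  have hn := whittleNum_nonneg hq0 hq1 n
  simp only [W_succ]
  rw [div_lt_div_iff₀ (by positivity) (by positivity)]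
  have key : whittleNum q m * (1 + (1 - 2 * q) ^ n) <
      whittleNum q n * (1 + (1 - 2 * q) ^ m) :=
    mul_lt_mul hN (by linarith) (by positivity) hn
  nlinarith [mul_lt_mul_of_pos_left key hq0]

theorem tendsto_W_succ {q : ℝ} (hq0 : 0 < q) (hq1 : q < 1 / 2) :
    Filter.Tendsto (fun n => W q (n + 1)) Filter.atTop (nhds (1 / (1 + 2 * q))) := by
  have hr0 : 0 ≤ 1 - 2 * q := by linarith
  have hr1 : 1 - 2 * q < 1 := by linarith
  have hp := tendsto_pow_atTop_nhds_zero_of_lt_one hr0 hr1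
  have hnp := tendsto_self_mul_const_pow_of_lt_one hr0 hr1
  have hN : Filter.Tendsto (whittleNum q) Filter.atTop (nhds 1) := by
    have h := (hp.add (hnp.const_mul (2 * q))).const_sub 1
    simp only [mul_zero, add_zero, sub_zero] at h
    refine h.congr fun n => ?_
    rw [whittleNum]
    ring
  have h := hN.div (hN.add ((hp.const_add 1).const_mul (2 * q))) (by linarith)
  simp only [add_zero, mul_one] at h
  exact h.congr fun n => (W_succ q n).symm

theorem stmt_13 (q : ℝ) (hq0 : 0 < q) (hq1 : q < 1/2)
    (D : ℝ) (hD0 : 0 ≤ D) (hD1 : D < 1 / (1 + 2*q)) :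
    ∃! H : ℕ, 1 ≤ H ∧ W q H ≤ D ∧ D < W q (H + 1) := by
  have hmono := W_succ_strictMono hq0 hq1
  have hex : ∃ n, D < W q (n + 1) :=
    ((tendsto_W_succ hq0 hq1).eventually (lt_mem_nhds hD1)).exists
  have hW1 : W q (0 + 1) = 0 := by simp [W_succ, whittleNum]
  classical
  obtain ⟨n, hn⟩ : ∃ n, Nat.find hex = n + 1 :=
    Nat.exists_eq_succ_of_ne_zero fun h0 => by
      have := Nat.find_spec hex
      rw [h0, hW1] at this
      linarith
  refine ⟨n + 1, ⟨by omega, ?_, ?_⟩, ?_⟩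
  · exact not_lt.mp (Nat.find_min hex (by omega))
  · rw [← hn]
    exact Nat.find_spec hex
  · rintro H ⟨hH1, hHle, hHlt⟩
    have h1 : Nat.find hex ≤ H := Nat.find_min' hex hHlt
    obtain ⟨k, rfl⟩ := Nat.exists_eq_add_of_le' hH1
    have h2 : k < Nat.find hex := hmono.lt_iff_lt.mp (hHle.trans_lt (Nat.find_spec hex))
    omega
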